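/- arXiv:1202.2986 — 2 statements merged into one kernel-verified Lean document; each statement's English description precedes it below -/
import Mathlib

section
/- Let r ≥ 3 be an odd integer and a ≥ r + 3 an even integer, let G be the Grundy sequence of S({1, a, a + r}), and set p = 2a + r. Then there exists N ∈ ℕ such that G(n + p) = G(n) for all n ≥ N, and for 0 ≤ i < p the values G(N + i) are given by: i mod 2 for 0 ≤ i ≤ r; 2 for i = r + 1; (i − r) mod 2 for r + 2 ≤ i ≤ a + r − 1; 2 for i = a + r; (i − a − r − 1) mod 2 for a + r + 1 ≤ i ≤ a + 2r + 1; 2 + (i − a − 2r − 2) mod 2 for a + 2r + 2 ≤ i ≤ 2a + r − 2; and 2 for i = 2a + r − 1. Moreover, for every c ≥ 1, G(n + c) ≠ G(n) holds for all n if and only if c ∈ {1, a, a + r} or c = s + m(2a + r) for some m ∈ ℕ and s ∈ {a + r + 2, 2a + r + 1, 3a + r}. -/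
/-- The minimum excludant: the least natural number not in `X`. -/
noncomputable def mex (X : Set ℕ) : ℕ := sInf {m | m ∉ X}

/-- `G` is the Grundy (nim-value) sequence of the subtraction game with
subtraction set `S`: `G n = mex { G (n - s) : s ∈ S, s ≤ n }`. -/
def IsGrundy (S : Finset ℕ) (G : ℕ → ℕ) : Prop :=
  ∀ n, G n = mex {v | ∃ s ∈ S, s ≤ n ∧ v = G (n - s)}

theorem mex_notMem {X : Set ℕ} (hX : X.Finite) : mex X ∉ X :=
  Nat.sInf_mem (s := {m | m ∉ X}) hX.infinite_compl.nonempty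

theorem mem_of_lt_mex {X : Set ℕ} {m : ℕ} (h : m < mex X) : m ∈ X := by
  by_contra hm
  exact Nat.notMem_of_lt_sInf h hm

theorem finite_options (S : Finset ℕ) (G : ℕ → ℕ) (n : ℕ) :
    {v | ∃ s ∈ S, s ≤ n ∧ v = G (n - s)}.Finite := by
  refine (S.image fun s => G (n - s)).finite_toSet.subset ?_
  rintro v ⟨s, hs, -, rfl⟩
  exact Finset.mem_coe.2 (Finset.mem_image_of_mem _ hs)

theorem IsGrundy.ne {S : Finset ℕ} {G : ℕ → ℕ} (hG : IsGrundy S G) {s n : ℕ}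
    (hs : s ∈ S) (hn : s ≤ n) : G n ≠ G (n - s) := by
  intro h
  rw [hG n] at h
  exact mex_notMem (finite_options S G n) ⟨s, hs, hn, h⟩

theorem IsGrundy.exists_of_lt {S : Finset ℕ} {G : ℕ → ℕ} (hG : IsGrundy S G) {m n : ℕ}
    (h : m < G n) : ∃ s ∈ S, s ≤ n ∧ m = G (n - s) := by
  rw [hG n] at h
  exact mem_of_lt_mex h

theorem IsGrundy.triple_spec {x y z : ℕ} {G : ℕ → ℕ} (hG : IsGrundy {x, y, z} G) (n : ℕ) :
    ((x ≤ n → G n ≠ G (n - x)) ∧ (y ≤ n → G n ≠ G (n - y)) ∧ (z ≤ n → G n ≠ G (n - z))) ∧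
      ∀ m < G n, (x ≤ n ∧ m = G (n - x)) ∨ (y ≤ n ∧ m = G (n - y)) ∨
        (z ≤ n ∧ m = G (n - z)) := by
  refine ⟨⟨hG.ne (by simp), hG.ne (by simp), hG.ne (by simp)⟩, fun m hm => ?_⟩
  simpa using hG.exists_of_lt hm

/-- `v` is the value at position `i` of the period of the game `S({1, a, a + r})`. -/
def IsPeriodValue (a r i v : ℕ) : Prop :=
  (i ≤ r → v = i % 2) ∧
  (i = r + 1 → v = 2) ∧
  (r + 2 ≤ i → i ≤ a + r - 1 → v = (i - r) % 2) ∧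
  (i = a + r → v = 2) ∧
  (a + r + 1 ≤ i → i ≤ a + 2 * r + 1 → v = (i - a - r - 1) % 2) ∧
  (a + 2 * r + 2 ≤ i → i ≤ 2 * a + r - 2 → v = 2 + (i - a - 2 * r - 2) % 2) ∧
  (i = 2 * a + r - 1 → v = 2)

/-- `v` is an admissible value at position `k < a + r` of a window which forces the following
`2 * a + r` values to form a period. -/
def IsWindowValue (a r k v : ℕ) : Prop :=
  (k < r → v = (k + 1) % 2) ∧
  (k = r → v = 2) ∧
  (r < k → k < 2 * r → v = (k - r - 1) % 2) ∧
  (k = 2 * r → v = 0 ∨ v = 2) ∧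
  (k = 2 * r + 1 → v = 1 ∨ v = 3) ∧
  (2 * r + 2 ≤ k → k < a + r → v = 2 + (k - 2 * r) % 2)

/-- `v` is the value at position `n < 2 * a` of the preperiod. -/
def IsPreperiodValue (a r n v : ℕ) : Prop :=
  (n < a → v = n % 2) ∧
  (n = a → v = 2) ∧
  (a < n → n < a + r → v = (n - a - 1) % 2) ∧
  (a + r ≤ n → v = 2 + (n - a - r) % 2)

variable {a r : ℕ} {G : ℕ → ℕ}

theorem IsPeriodValue.cases (ha : r + 3 ≤ a) {i v : ℕ} (hi : i < 2 * a + r)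
    (h : IsPeriodValue a r i v) :
    (i ≤ r ∧ v = i % 2) ∨ (i = r + 1 ∧ v = 2) ∨
    ((r + 2 ≤ i ∧ i ≤ a + r - 1) ∧ v = (i - r) % 2) ∨ (i = a + r ∧ v = 2) ∨
    ((a + r + 1 ≤ i ∧ i ≤ a + 2 * r + 1) ∧ v = (i - a - r - 1) % 2) ∨
    ((a + 2 * r + 2 ≤ i ∧ i ≤ 2 * a + r - 2) ∧ v = 2 + (i - a - 2 * r - 2) % 2) ∨
    (i = 2 * a + r - 1 ∧ v = 2) := by
  obtain ⟨h1, h2, h3, h4, h5, h6, h7⟩ := h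
  have hreg : i ≤ r ∨ i = r + 1 ∨ (r + 2 ≤ i ∧ i ≤ a + r - 1) ∨ i = a + r ∨
      (a + r + 1 ≤ i ∧ i ≤ a + 2 * r + 1) ∨ (a + 2 * r + 2 ≤ i ∧ i ≤ 2 * a + r - 2) ∨
      i = 2 * a + r - 1 := by
    clear h1 h2 h3 h4 h5 h6 h7
    omega
  rcases hreg with h | h | h | h | h | h | h
  · exact Or.inl ⟨h, h1 h⟩
  · exact Or.inr <| Or.inl ⟨h, h2 h⟩
  · exact Or.inr <| Or.inr <| Or.inl ⟨h, h3 h.1 h.2⟩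
  · exact Or.inr <| Or.inr <| Or.inr <| Or.inl ⟨h, h4 h⟩
  · exact Or.inr <| Or.inr <| Or.inr <| Or.inr <| Or.inl ⟨h, h5 h.1 h.2⟩
  · exact Or.inr <| Or.inr <| Or.inr <| Or.inr <| Or.inr <| Or.inl ⟨h, h6 h.1 h.2⟩
  · exact Or.inr <| Or.inr <| Or.inr <| Or.inr <| Or.inr <| Or.inr <| ⟨h, h7 h⟩

set_option maxHeartbeats 1000000 in
theorem preperiod (hr : 3 ≤ r) (hrodd : r % 2 = 1) (ha : r + 3 ≤ a)
    (haeven : a % 2 = 0) (hG : IsGrundy {1, a, a + r} G) (n : ℕ) (hn : n < 2 * a) :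
    IsPreperiodValue a r n (G n) := by
  induction n using Nat.strong_induction_on with
  | _ n ih =>
  obtain ⟨⟨h1, h2, h3⟩, h⟩ := hG.triple_spec n
  have m0 := h 0
  have m1 := h 1
  have m2 := h 2
  have m3 := h 3
  clear h
  have i1 : 1 ≤ n → _ := fun hh => ih (n - 1) (by omega) (by omega)
  have i2 : a ≤ n → _ := fun hh => ih (n - a) (by omega) (by omega)
  have i3 : a + r ≤ n → _ := fun hh => ih (n - (a + r)) (by omega) (by omega)
  clear ih
  generalize G (n - 1) = x at *
  generalize G (n - a) = y at *
  generalize G (n - (a + r)) = z at *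
  generalize G n = v at *
  clear hG
  have key : v = 0 ∨ v = 1 ∨ v = 2 ∨ v = 3 := by omega
  simp only [IsPreperiodValue] at i1 i2 i3 ⊢
  refine ⟨fun _ => ?_, fun _ => ?_, fun _ _ => ?_, fun _ => ?_⟩
  · clear i2 i3
    have hx : 1 ≤ n → x = (n - 1) % 2 := by clear h1 h2 h3 m0 m1 m2 m3 key; omega
    clear i1
    omega
  · have hx : x = 1 := by clear i2 i3 h1 h2 h3 m0 m1 m2 m3 key; omega
    have hy : y = 0 := by clear i1 i3 h1 h2 h3 m0 m1 m2 m3 key; omega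
    clear i1 i2 i3
    omega
  · have hx : n = a + 1 ∧ x = 2 ∨ x = (n - a) % 2 := by clear i2 i3 h1 h2 h3 m0 m1 m2 m3 key; omega
    have hy : y = (n - a) % 2 := by clear i1 i3 h1 h2 h3 m0 m1 m2 m3 key; omega
    clear i1 i2 i3
    omega
  · have hx : n = a + r ∧ x = 1 ∨ a + r < n ∧ x = 3 - (n - a - r) % 2 := by
      clear i2 i3 h1 h2 h3 m0 m1 m2 m3 key; omega
    have hy : y = (n - a) % 2 := by clear i1 i3 h1 h2 h3 m0 m1 m2 m3 key; omega
    have hz : z = (n - a - r) % 2 := by clear i1 i2 h1 h2 h3 m0 m1 m2 m3 key; omega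
    clear i1 i2 i3
    omega

set_option maxHeartbeats 1000000 in
theorem period_of_window (hr : 3 ≤ r) (hrodd : r % 2 = 1) (ha : r + 3 ≤ a)
    (haeven : a % 2 = 0) (hG : IsGrundy {1, a, a + r} G) (M : ℕ)
    (hw : ∀ k < a + r, IsWindowValue a r k (G (M + k))) (i : ℕ) (hi : i < 2 * a + r) :
    IsPeriodValue a r i (G (M + (a + r) + i)) := by
  induction i using Nat.strong_induction_on with
  | _ i ih =>
  obtain ⟨⟨h1, h2, h3⟩, h⟩ := hG.triple_spec (M + (a + r) + i)
  have m0 := h 0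
  have m1 := h 1
  have m2 := h 2
  have m3 := h 3
  clear h
  have x1 : i < 1 → IsWindowValue a r (a + r - 1) (G (M + (a + r) + i - 1)) := fun hh => by
    have := hw (a + r - 1) (by omega)
    rwa [show M + (a + r) + i - 1 = M + (a + r - 1) by omega]
  have x2 : 1 ≤ i → IsPeriodValue a r (i - 1) (G (M + (a + r) + i - 1)) := fun hh => by
    have := ih (i - 1) (by omega) (by omega)
    rwa [show M + (a + r) + i - 1 = M + (a + r) + (i - 1) by omega]
  have y1 : i < a → IsWindowValue a r (r + i) (G (M + (a + r) + i - a)) := fun hh => by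
    have := hw (r + i) (by omega)
    rwa [show M + (a + r) + i - a = M + (r + i) by omega]
  have y2 : a ≤ i → IsPeriodValue a r (i - a) (G (M + (a + r) + i - a)) := fun hh => by
    have := ih (i - a) (by omega) (by omega)
    rwa [show M + (a + r) + i - a = M + (a + r) + (i - a) by omega]
  have z1 : i < a + r → IsWindowValue a r i (G (M + (a + r) + i - (a + r))) := fun hh => by
    have := hw i (by omega)
    rwa [show M + (a + r) + i - (a + r) = M + i by omega]
  have z2 : a + r ≤ i → IsPeriodValue a r (i - (a + r)) (G (M + (a + r) + i - (a + r))) :=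
    fun hh => by
    have := ih (i - (a + r)) (by omega) (by omega)
    rwa [show M + (a + r) + i - (a + r) = M + (a + r) + (i - (a + r)) by omega]
  clear ih hw
  replace h1 := h1 (by omega)
  replace h2 := h2 (by omega)
  replace h3 := h3 (by omega)
  have e1 : 1 ≤ M + (a + r) + i := by omega
  have e2 : a ≤ M + (a + r) + i := by omega
  have e3 : a + r ≤ M + (a + r) + i := by omega
  simp only [e1, e2, e3, true_and] at m0 m1 m2 m3
  clear e1 e2 e3
  generalize G (M + (a + r) + i - 1) = x at *
  generalize G (M + (a + r) + i - a) = y at *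
  generalize G (M + (a + r) + i - (a + r)) = z at *
  generalize G (M + (a + r) + i) = v at *
  clear hG
  have key : v = 0 ∨ v = 1 ∨ v = 2 ∨ v = 3 := by omega
  replace x2 hh := (x2 hh).cases ha (by omega)
  replace y2 hh := (y2 hh).cases ha (by omega)
  replace z2 hh := (z2 hh).cases ha (by omega)
  simp only [IsPeriodValue, IsWindowValue] at x1 y1 z1 ⊢
  refine ⟨fun _ => ?_, fun _ => ?_, fun _ _ => ?_, fun _ => ?_, fun _ _ => ?_,
    fun _ _ => ?_, fun _ => ?_⟩
  · have hx : i = 0 ∧ x = 2 ∨ 0 < i ∧ x = (i + 1) % 2 := by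
      clear y1 y2 z1 z2 h1 h2 h3 m0 m1 m2 m3 key; omega
    have hy : y ≠ i % 2 := by
      clear x1 x2 z1 z2 hx h1 h2 h3 m0 m1 m2 m3 key; omega
    have hz : z ≠ i % 2 := by
      clear x1 x2 y1 y2 hx hy h1 h2 h3 m0 m1 m2 m3 key; omega
    clear x1 x2 y1 y2 z1 z2
    omega
  · have hx : x = 1 := by
      clear y1 y2 z1 z2 h1 h2 h3 m0 m1 m2 m3 key; omega
    have hy : y = 1 ∨ y = 3 := by
      clear x1 x2 z1 z2 hx h1 h2 h3 m0 m1 m2 m3 key; omega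
    have hz : z = 0 := by
      clear x1 x2 y1 y2 hx hy h1 h2 h3 m0 m1 m2 m3 key; omega
    clear x1 x2 y1 y2 z1 z2
    omega
  · have hx : i = r + 2 ∧ x = 2 ∨ r + 2 < i ∧ x = (i - r + 1) % 2 := by
      clear y1 y2 z1 z2 h1 h2 h3 m0 m1 m2 m3 key; omega
    have hy : y ≠ (i - r) % 2 := by
      clear x1 x2 z1 z2 hx h1 h2 h3 m0 m1 m2 m3 key; omega
    have hz : z ≠ (i - r) % 2 := by
      clear x1 x2 y1 y2 hx hy h1 h2 h3 m0 m1 m2 m3 key; omega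
    clear x1 x2 y1 y2 z1 z2
    omega
  · have hx : x = 1 := by
      clear y1 y2 z1 z2 h1 h2 h3 m0 m1 m2 m3 key; omega
    have hy : y = 1 := by
      clear x1 x2 z1 z2 hx h1 h2 h3 m0 m1 m2 m3 key; omega
    have hz : z = 0 := by
      clear x1 x2 y1 y2 hx hy h1 h2 h3 m0 m1 m2 m3 key; omega
    clear x1 x2 y1 y2 z1 z2
    omega
  · have hx : i = a + r + 1 ∧ x = 2 ∨ a + r + 1 < i ∧ x = (i - a - r) % 2 := by
      clear y1 y2 z1 z2 h1 h2 h3 m0 m1 m2 m3 key; omega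
    have hy : y ≠ (i - a - r - 1) % 2 := by
      clear x1 x2 z1 z2 hx h1 h2 h3 m0 m1 m2 m3 key; omega
    have hz : z ≠ (i - a - r - 1) % 2 := by
      clear x1 x2 y1 y2 hx hy h1 h2 h3 m0 m1 m2 m3 key; omega
    clear x1 x2 y1 y2 z1 z2
    omega
  · have hx : i = a + 2 * r + 2 ∧ x = 1 ∨ a + 2 * r + 2 < i ∧ x = 2 + (i - a - 2 * r - 1) % 2 := by
      clear y1 y2 z1 z2 h1 h2 h3 m0 m1 m2 m3 key; omega
    have hy : y = (i - a - r) % 2 := by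
      clear x1 x2 z1 z2 hx h1 h2 h3 m0 m1 m2 m3 key; omega
    have hz : z = (i - a - 2 * r) % 2 := by
      clear x1 x2 y1 y2 hx hy h1 h2 h3 m0 m1 m2 m3 key; omega
    clear x1 x2 y1 y2 z1 z2
    omega
  · have hx : x = 1 ∨ x = 3 := by
      clear y1 y2 z1 z2 h1 h2 h3 m0 m1 m2 m3 key; omega
    have hy : y = 1 := by
      clear x1 x2 z1 z2 hx h1 h2 h3 m0 m1 m2 m3 key; omega
    have hz : z = 0 := by
      clear x1 x2 y1 y2 hx hy h1 h2 h3 m0 m1 m2 m3 key; omega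
    clear x1 x2 y1 y2 z1 z2
    omega

theorem window_of_preperiod (hrodd : r % 2 = 1) (ha : r + 3 ≤ a)
    (haeven : a % 2 = 0) {k v : ℕ}
    (h : IsPreperiodValue a r (a - r + k) v) : IsWindowValue a r k v := by
  simp only [IsPreperiodValue, IsWindowValue] at h ⊢
  refine ⟨?_, ?_, ?_, ?_, ?_, ?_⟩ <;> omega

theorem window_of_period (hr : 3 ≤ r) (hrodd : r % 2 = 1) (ha : r + 3 ≤ a)
    (haeven : a % 2 = 0) {k v : ℕ} (hk : k < a + r)
    (h : IsPeriodValue a r (a + k) v) : IsWindowValue a r k v := by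
  have h := h.cases ha (by omega)
  simp only [IsWindowValue]
  refine ⟨?_, ?_, ?_, ?_, ?_, ?_⟩ <;> omega

theorem period (hr : 3 ≤ r) (hrodd : r % 2 = 1) (ha : r + 3 ≤ a) (haeven : a % 2 = 0)
    (hG : IsGrundy {1, a, a + r} G) (q i : ℕ) (hi : i < 2 * a + r) :
    IsPeriodValue a r i (G (2 * a + q * (2 * a + r) + i)) := by
  induction q generalizing i with
  | zero =>
    have h := period_of_window hr hrodd ha haeven hG (a - r)
      (fun k hk => window_of_preperiod hrodd ha haeven
        (preperiod hr hrodd ha haeven hG _ (by omega))) i hi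
    rwa [show 2 * a + 0 * (2 * a + r) + i = a - r + (a + r) + i by omega]
  | succ q ih =>
    have h := period_of_window hr hrodd ha haeven hG (2 * a + q * (2 * a + r) + a)
      (fun k hk => window_of_period hr hrodd ha haeven hk (by
        rw [add_assoc]; exact ih _ (by omega))) i hi
    rwa [show 2 * a + (q + 1) * (2 * a + r) + i =
      2 * a + q * (2 * a + r) + a + (a + r) + i by ring]

theorem IsPeriodValue.unique (ha : r + 3 ≤ a) {i v w : ℕ} (hi : i < 2 * a + r)
    (hv : IsPeriodValue a r i v) (hw : IsPeriodValue a r i w) : v = w := by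
  obtain ⟨h1, h2, h3, h4, h5, h6, h7⟩ := hw
  rcases hv.cases ha hi with ⟨h, hv⟩ | ⟨h, hv⟩ | ⟨h, hv⟩ | ⟨h, hv⟩ | ⟨h, hv⟩ | ⟨h, hv⟩ | ⟨h, hv⟩
  · rw [hv, h1 h]
  · rw [hv, h2 h]
  · rw [hv, h3 h.1 h.2]
  · rw [hv, h4 h]
  · rw [hv, h5 h.1 h.2]
  · rw [hv, h6 h.1 h.2]
  · rw [hv, h7 h]

theorem periodic (hr : 3 ≤ r) (hrodd : r % 2 = 1) (ha : r + 3 ≤ a) (haeven : a % 2 = 0)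
    (hG : IsGrundy {1, a, a + r} G) {n : ℕ} (hn : 2 * a ≤ n) (m : ℕ) :
    G (n + m * (2 * a + r)) = G n := by
  have hi : (n - 2 * a) % (2 * a + r) < 2 * a + r := Nat.mod_lt _ (by omega)
  have hd := Nat.mod_add_div' (n - 2 * a) (2 * a + r)
  generalize (n - 2 * a) % (2 * a + r) = i at hi hd
  generalize (n - 2 * a) / (2 * a + r) = q at hd
  obtain rfl : n = 2 * a + q * (2 * a + r) + i := by omega
  refine IsPeriodValue.unique ha hi ?_ (period hr hrodd ha haeven hG q i hi)
  have h := period hr hrodd ha haeven hG (q + m) i hi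
  rwa [show 2 * a + q * (2 * a + r) + i + m * (2 * a + r) =
    2 * a + (q + m) * (2 * a + r) + i by ring]

theorem not_safe_of_residue (hr : 3 ≤ r) (hrodd : r % 2 = 1) (ha : r + 3 ≤ a)
    (haeven : a % 2 = 0) (hG : IsGrundy {1, a, a + r} G) {t : ℕ} (m : ℕ) (ht : t < 2 * a + r)
    (h1 : t ≠ 1) (h2 : t ≠ a) (h3 : t ≠ a + r + 2) (h4 : t = a + r → m ≠ 0) :
    ∃ n, G (n + (t + m * (2 * a + r))) = G n := by
  have hP := period hr hrodd ha haeven hG 0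
  have hQ := fun n hn => preperiod hr hrodd ha haeven hG n hn
  simp only [zero_mul, add_zero] at hP
  have steady : ∀ i, i < 2 * a + r → (∃ j < 2 * a + r, (i + t = j ∨ i + t = j + (2 * a + r)) ∧
      ∀ v w, IsPeriodValue a r i v → IsPeriodValue a r j w → w = v) →
      ∃ n, G (n + (t + m * (2 * a + r))) = G n := by
    rintro i hi ⟨j, hj, hij, h⟩
    refine ⟨2 * a + i, ?_⟩
    rw [← add_assoc, periodic hr hrodd ha haeven hG (by omega),
      ← h _ _ (hP i hi) (hP j hj)]
    rcases hij with hij | hij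
    · rw [add_assoc, hij]
    · rw [add_assoc, hij, ← add_assoc]
      simpa using periodic hr hrodd ha haeven hG (n := 2 * a + j) (by omega) 1
  have initial : ∀ k j, j < 2 * a + r →
      t + m * (2 * a + r) = 2 * a + j + k * (2 * a + r) →
      (∀ w, IsPeriodValue a r j w → w = 0) →
      ∃ n, G (n + (t + m * (2 * a + r))) = G n := by
    intro k j hj hc h
    refine ⟨0, ?_⟩
    rw [zero_add, hc, periodic hr hrodd ha haeven hG (by omega), h _ (hP j hj),
      (hQ 0 (by omega)).1 (by omega)]
  have cross (hm : m ≠ 0) : t + m * (2 * a + r) = t + (2 * a + r) + (m - 1) * (2 * a + r) := by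
    obtain ⟨k, rfl⟩ := Nat.exists_eq_succ_of_ne_zero hm
    simp only [Nat.succ_eq_add_one, Nat.add_sub_cancel]
    ring
  rcases Nat.mod_two_eq_zero_or_one t with hpar | hpar
  · rcases Nat.lt_or_ge t (a - 2) with hlt | hge
    · exact steady (r + 2) (by omega) ⟨r + 2 + t, by omega, by omega, fun v w hv hw => by
        rw [hw.2.2.1 (by omega) (by omega), hv.2.2.1 (by omega) (by omega)]
        omega⟩
    rcases Nat.lt_or_ge t a with hlt | hge
    · rcases eq_or_ne m 0 with rfl | hm
      · refine ⟨0, ?_⟩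
        rw [zero_mul, zero_add, add_zero, (hQ 0 (by omega)).1 (by omega),
          (hQ t (by omega)).1 hlt, hpar]
      · refine initial (m - 1) (t + r) (by omega) ?_ (fun w hw => by
        rw [hw.2.2.1 (by omega) (by omega)]
        omega)
        rw [cross hm]
        omega
    rcases Nat.lt_or_ge t (2 * a + r - 1) with hlt | hge
    · rcases Nat.lt_or_ge (2 * a + r - t) (r + 2) with _ | _
      · exact steady (r + 2) (by omega)
          ⟨r + 2 + t - (2 * a + r), by omega, by omega, fun v w hv hw => by
        rw [hw.1 (by omega), hv.2.2.1 (by omega) (by omega)]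
        omega⟩
      · exact steady (2 * a + r - t) (by omega) ⟨0, by omega, by omega, fun v w hv hw => by
        rw [hw.1 (by omega), hv.2.2.1 (by omega) (by omega)]
        omega⟩
    · exact initial m (r - 1) (by omega) (by omega) (fun w hw => by
        rw [hw.1 (by omega)]
        omega)
  · rcases Nat.lt_or_ge t (r + 2) with hlt | hge
    · exact steady (r + 2 - t) (by omega) ⟨r + 2, by omega, by omega, fun v w hv hw => by
        rw [hw.2.2.1 (by omega) (by omega), hv.1 (by omega)]
        omega⟩
    rcases Nat.lt_or_ge t (a + r) with hlt | hge
    · exact steady 0 (by omega) ⟨t, by omega, by omega, fun v w hv hw => by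
        rw [hw.2.2.1 (by omega) (by omega), hv.1 (by omega)]
        omega⟩
    rcases Nat.lt_or_ge t (a + r + 2) with hlt | hge
    · refine initial (m - 1) (t + r) (by omega) ?_ (fun w hw => by
        rw [hw.2.2.2.2.1 (by omega) (by omega)]
        omega)
      rw [cross (h4 (by omega))]
      omega
    · exact steady (r + 2 + (2 * a + r - t)) (by omega)
        ⟨r + 2, by omega, by omega, fun v w hv hw => by
        rw [hw.2.2.1 (by omega) (by omega), hv.2.2.1 (by omega) (by omega)]
        omega⟩

theorem periodValue_ne_of_preperiodValue (hr : 3 ≤ r) (hrodd : r % 2 = 1) (ha : r + 3 ≤ a)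
    (haeven : a % 2 = 0) {n j v w : ℕ} (hn : n < 2 * a) (hj : j < 2 * a + r)
    (hv : IsPreperiodValue a r n v) (hw : IsPeriodValue a r j w)
    (h : j = n + r + 1 ∨ j + (2 * a + r) = n + r + 1 ∨ j = n + a + r ∨ j + a = n ∨
      j + a = n + r + 2 ∨ j = n + a + 2 * r + 2) : w ≠ v := by
  simp only [IsPreperiodValue] at hv
  have hw := hw.cases ha hj
  rcases h with h | h | h | h | h | h <;> omega

theorem preperiodValue_ne (hr : 3 ≤ r) (hrodd : r % 2 = 1)
    (haeven : a % 2 = 0) {n v w : ℕ} (hn : n + a + r + 2 < 2 * a)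
    (hv : IsPreperiodValue a r n v) (hw : IsPreperiodValue a r (n + a + r + 2) w) : w ≠ v := by
  simp only [IsPreperiodValue] at hv hw
  omega

theorem periodValue_ne (hr : 3 ≤ r) (hrodd : r % 2 = 1) (ha : r + 3 ≤ a)
    (haeven : a % 2 = 0) {i j v w : ℕ} (hi : i < 2 * a + r) (hj : j < 2 * a + r)
    (hv : IsPeriodValue a r i v) (hw : IsPeriodValue a r j w)
    (h : j = i + a + r + 2 ∨ j + a = i + 2) : w ≠ v := by
  have hv := hv.cases ha hi
  have hw := hw.cases ha hj
  rcases h with h | h <;>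
    rcases hv with ⟨h', hv⟩ | ⟨h', hv⟩ | ⟨h', hv⟩ | ⟨h', hv⟩ | ⟨h', hv⟩ | ⟨h', hv⟩ | ⟨h', hv⟩ <;>
    omega

theorem ne_of_le (hr : 3 ≤ r) (hrodd : r % 2 = 1) (ha : r + 3 ≤ a) (haeven : a % 2 = 0)
    (hG : IsGrundy {1, a, a + r} G) {n : ℕ} (hn : 2 * a ≤ n) : G (n + (a + r + 2)) ≠ G n := by
  have hi : (n - 2 * a) % (2 * a + r) < 2 * a + r := Nat.mod_lt _ (by omega)
  have hd := Nat.mod_add_div' (n - 2 * a) (2 * a + r)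
  generalize (n - 2 * a) % (2 * a + r) = i at hi hd
  generalize (n - 2 * a) / (2 * a + r) = q at hd
  obtain rfl : n = 2 * a + q * (2 * a + r) + i := by omega
  rcases Nat.lt_or_ge (i + a + r + 2) (2 * a + r) with hlt | hge
  · refine periodValue_ne hr hrodd ha haeven hi hlt (period hr hrodd ha haeven hG q i hi)
      ?_ (Or.inl rfl)
    have h := period hr hrodd ha haeven hG q _ hlt
    rwa [show 2 * a + q * (2 * a + r) + i + (a + r + 2) =
      2 * a + q * (2 * a + r) + (i + a + r + 2) by ring]
  · refine periodValue_ne hr hrodd ha haeven (j := i + 2 - a) hi (by omega)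
      (period hr hrodd ha haeven hG q i hi) ?_ (Or.inr (by omega))
    have h := period hr hrodd ha haeven hG (q + 1) (i + 2 - a) (by omega)
    rwa [show 2 * a + q * (2 * a + r) + i + (a + r + 2) =
      2 * a + (q + 1) * (2 * a + r) + (i + 2 - a) by rw [add_one_mul]; omega]

theorem safe_add_period (hr : 3 ≤ r) (hrodd : r % 2 = 1) (ha : r + 3 ≤ a)
    (haeven : a % 2 = 0) (hG : IsGrundy {1, a, a + r} G) {s : ℕ} (m : ℕ)
    (hs : s = a + r + 2 ∨ s = 2 * a + r + 1 ∨ s = 3 * a + r) (n : ℕ) :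
    G (n + (s + m * (2 * a + r))) ≠ G n := by
  have hper {x} (hx : 2 * a ≤ x) (k) := periodic hr hrodd ha haeven hG hx k
  rcases Nat.lt_or_ge n (2 * a) with hn | hn
  · have hQ := preperiod hr hrodd ha haeven hG n hn
    have main (k j) (hj : j < 2 * a + r)
        (he : n + (s + m * (2 * a + r)) = 2 * a + k * (2 * a + r) + j)
        (h : j = n + r + 1 ∨ j + (2 * a + r) = n + r + 1 ∨ j = n + a + r ∨ j + a = n ∨
          j + a = n + r + 2 ∨ j = n + a + 2 * r + 2) :
        G (n + (s + m * (2 * a + r))) ≠ G n := by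
      rw [he]
      exact periodValue_ne_of_preperiodValue hr hrodd ha haeven hn hj hQ
        (period hr hrodd ha haeven hG k j hj) h
    have hsucc := add_one_mul m (2 * a + r)
    rcases hs with rfl | rfl | rfl
    · rcases Nat.lt_or_ge (n + a + r + 2) (2 * a) with hlt | hge
      · cases m with
        | zero =>
          rw [show n + (a + r + 2 + 0 * (2 * a + r)) = n + a + r + 2 by ring]
          exact preperiodValue_ne hr hrodd haeven hlt hQ
            (preperiod hr hrodd ha haeven hG _ hlt)
        | succ k =>
          exact main k (n + a + 2 * r + 2) (by omega) (by ring) (by omega)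
      · exact main m (n + r + 2 - a) (by omega) (by omega) (by omega)
    · rcases Nat.lt_or_ge (n + r + 1) (2 * a + r) with _ | _
      · exact main m (n + r + 1) (by omega) (by omega) (by omega)
      · exact main (m + 1) (n + r + 1 - (2 * a + r)) (by omega) (by omega) (by omega)
    · rcases Nat.lt_or_ge (n + a + r) (2 * a + r) with _ | _
      · exact main m (n + a + r) (by omega) (by omega) (by omega)
      · exact main (m + 1) (n - a) (by omega) (by omega) (by omega)
  · rcases hs with rfl | rfl | rfl
    · rw [← add_assoc, hper (by omega)]
      exact ne_of_le hr hrodd ha haeven hG hn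
    · rw [show n + (2 * a + r + 1 + m * (2 * a + r)) = n + 1 + (m + 1) * (2 * a + r) by ring,
        hper (by omega)]
      simpa using hG.ne (s := 1) (n := n + 1) (by simp) (by omega)
    · rw [show n + (3 * a + r + m * (2 * a + r)) = n + a + (m + 1) * (2 * a + r) by ring,
        hper (by omega)]
      simpa using hG.ne (s := a) (n := n + a) (by simp) (by omega)

theorem stmt_6 (a r : ℕ) (hr : 3 ≤ r) (hrodd : Odd r) (ha : r + 3 ≤ a)
    (haeven : Even a) (G : ℕ → ℕ) (hG : IsGrundy {1, a, a + r} G) :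
    (∃ N : ℕ, (∀ n, N ≤ n → G (n + (2 * a + r)) = G n) ∧
      ∀ i < 2 * a + r,
        (i ≤ r → G (N + i) = i % 2) ∧
        (i = r + 1 → G (N + i) = 2) ∧
        (r + 2 ≤ i → i ≤ a + r - 1 → G (N + i) = (i - r) % 2) ∧
        (i = a + r → G (N + i) = 2) ∧
        (a + r + 1 ≤ i → i ≤ a + 2 * r + 1 → G (N + i) = (i - a - r - 1) % 2) ∧
        (a + 2 * r + 2 ≤ i → i ≤ 2 * a + r - 2 →
          G (N + i) = 2 + (i - a - 2 * r - 2) % 2) ∧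
        (i = 2 * a + r - 1 → G (N + i) = 2)) ∧
    (∀ c, 1 ≤ c →
      ((∀ n, G (n + c) ≠ G n) ↔
        (c = 1 ∨ c = a ∨ c = a + r ∨
          ∃ s m : ℕ, c = s + m * (2 * a + r) ∧
            (s = a + r + 2 ∨ s = 2 * a + r + 1 ∨ s = 3 * a + r)))) := by
  replace hrodd := Nat.odd_iff.1 hrodd
  replace haeven := Nat.even_iff.1 haeven
  refine ⟨⟨2 * a, fun n hn => ?_, fun i hi => ?_⟩, fun c hc => ⟨fun h => ?_, ?_⟩⟩
  · simpa using periodic hr hrodd ha haeven hG hn 1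
  · have h := period hr hrodd ha haeven hG 0 i hi
    rw [zero_mul, add_zero] at h
    exact h
  · by_contra hcon
    push Not at hcon
    obtain ⟨c1, ca, car, hcon⟩ := hcon
    have ht : c % (2 * a + r) < 2 * a + r := Nat.mod_lt _ (by omega)
    have hd := Nat.mod_add_div' c (2 * a + r)
    generalize c % (2 * a + r) = t at ht hd
    generalize c / (2 * a + r) = m at hd
    subst hd
    have wrap (s k : ℕ) (hm : m = k + 1) (hs : s = t + (2 * a + r)) :=
      hcon s k (by rw [hm, hs]; ring)
    obtain ⟨n, hn⟩ := not_safe_of_residue hr hrodd ha haeven hG m ht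
      (by
        rintro rfl
        cases m with
        | zero => simp at c1
        | succ k => exact (wrap _ k rfl rfl).2.1 (by ring))
      (by
        rintro rfl
        cases m with
        | zero => simp at ca
        | succ k => exact (wrap _ k rfl rfl).2.2 (by ring))
      (fun he => (hcon t m rfl).1 he)
      (by
        rintro rfl rfl
        simp at car)
    exact h n hn
  · rintro (rfl | rfl | rfl | ⟨s, m, rfl, hs⟩) n
    · simpa using hG.ne (s := 1) (n := n + 1) (by simp) (by omega)
    · simpa using hG.ne (s := c) (n := n + c) (by simp) (by omega)
    · simpa using hG.ne (s := a + r) (n := n + (a + r)) (by simp) (by omega)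
    · exact safe_add_period hr hrodd ha haeven hG m hs n
end

section
/- Let a ≥ 4 be an even integer, let G be the Grundy sequence of S({1, a, 3a − 2}), and set p = 3a − 1. Then there exists N ∈ ℕ such that G(n + p) = G(n) for all n ≥ N, and for 0 ≤ i < p the values G(N + i) are given by: i mod 2 for 0 ≤ i ≤ a − 3; 2 for i = a − 2; (i − a + 1) mod 2 for a − 1 ≤ i ≤ 2a − 2; 2 for i = 2a − 1; (i − 2a) mod 2 for 2a ≤ i ≤ 3a − 3; and 2 for i = 3a − 2. Moreover, for every c ≥ 1, G(n + c) ≠ G(n) holds for all n if and only if: in case a = 4, c ∈ {1, 4, 10}; and in case a > 4, c ∈ {1, a, 3a − 2, 3a} or c = s + m(3a − 1) for some m ∈ ℕ and s ∈ {4a − 1, 6a − 1}. -/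
/-- One period of the eventual Grundy sequence of the subtraction set `{1, a, 3 * a - 2}`. -/
def grundyPeriod (a i : ℕ) : ℕ :=
  if i ≤ a - 3 then i % 2
  else if i = a - 2 then 2
  else if i ≤ 2 * a - 2 then (i + 1 - a) % 2
  else if i = 2 * a - 1 then 2
  else if i ≤ 3 * a - 3 then (i - 2 * a) % 2
  else 2

theorem grundyPeriod_cases {a : ℕ} (ha : 4 ≤ a) (i : ℕ) :
    (i ≤ a - 3 ∧ grundyPeriod a i = i % 2) ∨ (i = a - 2 ∧ grundyPeriod a i = 2) ∨
    (a - 1 ≤ i ∧ i ≤ 2 * a - 2 ∧ grundyPeriod a i = (i + 1 - a) % 2) ∨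
    (i = 2 * a - 1 ∧ grundyPeriod a i = 2) ∨
    (2 * a ≤ i ∧ i ≤ 3 * a - 3 ∧ grundyPeriod a i = (i - 2 * a) % 2) ∨
    (3 * a - 2 ≤ i ∧ grundyPeriod a i = 2) := by
  unfold grundyPeriod
  split_ifs <;> omega

set_option maxHeartbeats 2000000 in
/-- The mex rule for the value at position `i` of a block, given the values `x`, `y`, `z` at
distance `1`, `a`, `3 * a - 2` before it, where `f`, `e` are the values at positions `3 * a - 4`
and `3 * a - 3` of the previous block. -/
theorem grundyPeriod_mex {a i x y z e f : ℕ} (ha : 4 ≤ a) (heven : Even a) (hi : i < 3 * a - 1)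
    (he : e = 1 ∨ e = 3) (hf : f = 0 ∨ 4 < a ∧ f = 2)
    (hx : i = 0 ∧ x = 2 ∨ 0 < i ∧ x = grundyPeriod a (i - 1))
    (hy : i = a - 2 ∧ y = e ∨ i = a - 3 ∧ y = f ∨
      ∃ j, y = grundyPeriod a j ∧
        (i < a ∧ i ≠ a - 2 ∧ i ≠ a - 3 ∧ j = 2 * a - 1 + i ∨ j + a = i))
    (hz : i = 3 * a - 4 ∧ z = e ∨ i = 3 * a - 5 ∧ z = f ∨
      ∃ j, z = grundyPeriod a j ∧ (i = 3 * a - 2 ∧ j = 0 ∨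
        i ≠ 3 * a - 2 ∧ i ≠ 3 * a - 4 ∧ i ≠ 3 * a - 5 ∧ j = i + 1)) :
    x ≠ grundyPeriod a i ∧ y ≠ grundyPeriod a i ∧ z ≠ grundyPeriod a i ∧
      ∀ w < grundyPeriod a i, x = w ∨ y = w ∨ z = w := by
  obtain ⟨b, rfl⟩ := heven
  revert he hf hx hy hz
  rcases grundyPeriod_cases ha i with c | c | c | c | c | c
  all_goals
    rintro he hf (⟨hi0, hx⟩ | ⟨hi0, hx⟩)
    on_goal 2 =>
      rcases grundyPeriod_cases ha (i - 1) with cx | cx | cx | cx | cx | cx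
    all_goals try (clear he hf; exfalso; omega)
  all_goals
    rintro (⟨hia, hy⟩ | ⟨hia, hy⟩ | ⟨j, hy, ⟨hia, hi2, hi3, hj⟩ | hj⟩)
    on_goal 3 => rcases grundyPeriod_cases ha j with cy | cy | cy | cy | cy | cy
    on_goal 9 => rcases grundyPeriod_cases ha j with cy | cy | cy | cy | cy | cy
    all_goals try (clear he hf; exfalso; omega)
  all_goals
    rintro (⟨hib, hz⟩ | ⟨hib, hz⟩ | ⟨k, hz, ⟨hib, hk⟩ | ⟨hib, hi4, hi5, hk⟩⟩)
    on_goal 3 => rcases grundyPeriod_cases ha k with cz | cz | cz | cz | cz | cz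
    on_goal 9 => rcases grundyPeriod_cases ha k with cz | cz | cz | cz | cz | cz
    all_goals try (clear he hf; exfalso; omega)
  all_goals
    refine ⟨by omega, by omega, by omega, fun w hw => ?_⟩
    have hw' : w = 0 ∨ w = 1 := by omega
    rcases hw' with rfl | rfl <;> omega

/-- The Grundy sequence of `{1, a, 3 * a - 2}` up to position `3 * a`, for `4 < a`. -/
def grundyStart (a n : ℕ) : ℕ :=
  if n < a then n % 2
  else if n = a then 2
  else if n ≤ 2 * a then (n - a - 1) % 2
  else if n = 2 * a + 1 then 2
  else if n ≤ 3 * a - 3 then n % 2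
  else if n = 3 * a - 1 then 3
  else 2

theorem grundyStart_cases {a : ℕ} (ha : 4 < a) (n : ℕ) :
    (n < a ∧ grundyStart a n = n % 2) ∨ (n = a ∧ grundyStart a n = 2) ∨
    (a + 1 ≤ n ∧ n ≤ 2 * a ∧ grundyStart a n = (n - a - 1) % 2) ∨
    (n = 2 * a + 1 ∧ grundyStart a n = 2) ∨
    (2 * a + 2 ≤ n ∧ n ≤ 3 * a - 3 ∧ grundyStart a n = n % 2) ∨
    (n = 3 * a - 1 ∧ grundyStart a n = 3) ∨
    (3 * a - 2 ≤ n ∧ n ≠ 3 * a - 1 ∧ grundyStart a n = 2) := by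
  unfold grundyStart
  split_ifs <;> omega

theorem grundyStart_sub_one_ne {a n : ℕ} (ha : 4 < a) (heven : Even a) (hn : n < 3 * a + 1)
    (h : 1 ≤ n) : grundyStart a (n - 1) ≠ grundyStart a n := by
  obtain ⟨b, rfl⟩ := heven
  rcases grundyStart_cases ha n with c | c | c | c | c | c | c <;>
  have c1 := grundyStart_cases ha (n - 1) <;> omega

theorem grundyStart_sub_ne {a n : ℕ} (ha : 4 < a) (heven : Even a) (hn : n < 3 * a + 1)
    (h : a ≤ n) : grundyStart a (n - a) ≠ grundyStart a n := by
  obtain ⟨b, rfl⟩ := heven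
  rcases grundyStart_cases ha n with c | c | c | c | c | c | c <;>
  have c1 := grundyStart_cases ha (n - (b + b)) <;> omega

theorem grundyStart_sub_ne' {a n : ℕ} (ha : 4 < a) (heven : Even a) (hn : n < 3 * a + 1)
    (h : 3 * a - 2 ≤ n) : grundyStart a (n - (3 * a - 2)) ≠ grundyStart a n := by
  obtain ⟨b, rfl⟩ := heven
  rcases grundyStart_cases ha n with c | c | c | c | c | c | c <;>
  have c1 := grundyStart_cases ha (n - (3 * (b + b) - 2)) <;> omega

theorem grundyStart_lt {a n w : ℕ} (ha : 4 < a) (heven : Even a) (hn : n < 3 * a + 1)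
    (hw : w < grundyStart a n) :
    1 ≤ n ∧ grundyStart a (n - 1) = w ∨ a ≤ n ∧ grundyStart a (n - a) = w ∨
      3 * a - 2 ≤ n ∧ grundyStart a (n - (3 * a - 2)) = w := by
  obtain ⟨b, rfl⟩ := heven
  have c1 := grundyStart_cases ha (n - 1)
  have c2 := grundyStart_cases ha (n - (b + b))
  rcases grundyStart_cases ha n with c | c | c | c | c | c | c
  · omega
  · omega
  · omega
  · omega
  · omega
  · have c3 := grundyStart_cases ha (n - (3 * (b + b) - 2))
    obtain rfl | rfl | rfl : w = 0 ∨ w = 1 ∨ w = 2 := by omega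
    all_goals omega
  · have c3 := grundyStart_cases ha (n - (3 * (b + b) - 2))
    obtain rfl | rfl : w = 0 ∨ w = 1 := by omega
    all_goals omega

/-- The first values of the Grundy sequence of `{1, 4, 10}`. -/
def grundyFour : List ℕ :=
  [0, 1, 0, 1, 2, 0, 1, 0, 1, 2, 3, 2, 3, 0, 1, 3, 0, 1, 0, 1, 2, 0, 1, 2, 0, 1, 2, 0, 1, 0, 1, 2,
    0, 1, 2]

namespace IsGrundy

variable {S : Finset ℕ} {G : ℕ → ℕ}

theorem apply_sub_ne (hG : IsGrundy S G) {n s : ℕ} (hs : s ∈ S) (hsn : s ≤ n) :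
    G (n - s) ≠ G n := by
  intro h
  have hne : {m | m ∉ {v | ∃ s ∈ S, s ≤ n ∧ v = G (n - s)}}.Nonempty := by
    refine Set.Finite.infinite_compl ?_ |>.nonempty
    refine (S.finite_toSet.image fun s => G (n - s)).subset ?_
    rintro v ⟨s, hs, -, rfl⟩
    exact ⟨s, hs, rfl⟩
  have hmem := Nat.sInf_mem hne
  refine hmem ⟨s, hs, hsn, ?_⟩
  rw [h, hG n]
  rfl

theorem apply_add_ne (hG : IsGrundy S G) {s : ℕ} (hs : s ∈ S) (n : ℕ) : G (n + s) ≠ G n := by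
  have h := hG.apply_sub_ne hs (Nat.le_add_left s n)
  rw [Nat.add_sub_cancel] at h
  exact h.symm

theorem eq_of_forall (hG : IsGrundy S G) {n v : ℕ}
    (hne : ∀ s ∈ S, s ≤ n → G (n - s) ≠ v)
    (hlt : ∀ w < v, ∃ s ∈ S, s ≤ n ∧ G (n - s) = w) : G n = v := by
  rw [hG n]
  refine le_antisymm (Nat.sInf_le ?_) (le_csInf ⟨v, ?_⟩ ?_)
  · rintro ⟨s, hs, hsn, h⟩
    exact hne s hs hsn h.symm
  · rintro ⟨s, hs, hsn, h⟩
    exact hne s hs hsn h.symm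
  · intro m hm
    by_contra! hmv
    obtain ⟨s, hs, hsn, h⟩ := hlt m hmv
    exact hm ⟨s, hs, hsn, h.symm⟩

/-- A function obeying the mex rule below `B` agrees with the Grundy sequence there. -/
theorem eq_of_lt (hG : IsGrundy S G) (hS : ∀ s ∈ S, 0 < s) (H : ℕ → ℕ) (B : ℕ)
    (hne : ∀ n < B, ∀ s ∈ S, s ≤ n → H (n - s) ≠ H n)
    (hlt : ∀ n < B, ∀ w < H n, ∃ s ∈ S, s ≤ n ∧ H (n - s) = w) : ∀ n < B, G n = H n := by
  intro n
  induction n using Nat.strong_induction_on with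
  | _ n ih =>
    intro hn
    have key : ∀ s ∈ S, s ≤ n → G (n - s) = H (n - s) := fun s hs hsn =>
      ih _ (by have := hS s hs; omega) (by omega)
    refine hG.eq_of_forall (fun s hs hsn => ?_) (fun w hw => ?_)
    · rw [key s hs hsn]
      exact hne n hn s hs hsn
    · obtain ⟨s, hs, hsn, h⟩ := hlt n hn w hw
      exact ⟨s, hs, hsn, (key s hs hsn).trans h⟩

variable {a : ℕ}

theorem eq_of_three (hG : IsGrundy {1, a, 3 * a - 2} G) {n v x y z : ℕ} (ha : 1 ≤ a)
    (hn : 3 * a - 2 ≤ n) (hx : G (n - 1) = x) (hy : G (n - a) = y)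
    (hz : G (n - (3 * a - 2)) = z) (hxv : x ≠ v) (hyv : y ≠ v) (hzv : z ≠ v)
    (hlt : ∀ w < v, x = w ∨ y = w ∨ z = w) : G n = v := by
  subst hx hy hz
  refine hG.eq_of_forall ?_ ?_
  · simp [hxv, hyv, hzv]
  · intro w hw
    rcases hlt w hw with h | h | h
    · exact ⟨1, by simp, by omega, h⟩
    · exact ⟨a, by simp, by omega, h⟩
    · exact ⟨3 * a - 2, by simp, by omega, h⟩

/-- The pattern `grundyPeriod a` propagates to the next block, even if (for `4 < a`) the entries
`0`, `1` at positions `3 * a - 4`, `3 * a - 3` of the current block are replaced by `2`, `3`. -/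
theorem next_block (hG : IsGrundy {1, a, 3 * a - 2} G) (ha : 4 ≤ a) (heven : Even a) {M : ℕ}
    (hM : ∀ i < 3 * a - 1, i ≠ 3 * a - 3 → i ≠ 3 * a - 4 →
      G (M + i) = grundyPeriod a i)
    (hM' : G (M + (3 * a - 3)) = 1 ∨ G (M + (3 * a - 3)) = 3)
    (hM'' : G (M + (3 * a - 4)) = 0 ∨ 4 < a ∧ G (M + (3 * a - 4)) = 2) :
    ∀ i < 3 * a - 1, G (M + (3 * a - 1) + i) = grundyPeriod a i := by
  obtain ⟨b, rfl⟩ := heven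
  intro i
  induction i using Nat.strong_induction_on with
  | _ i ih =>
    intro hi
    have key := grundyPeriod_mex (i := i) (x := G (M + (3 * (b + b) - 1) + i - 1))
      (y := G (M + (3 * (b + b) - 1) + i - (b + b)))
      (z := G (M + (3 * (b + b) - 1) + i - (3 * (b + b) - 2))) ha ⟨b, rfl⟩ hi hM' hM'' ?_ ?_ ?_
    · obtain ⟨h1, h2, h3, h4⟩ := key
      exact hG.eq_of_three (by omega) (by omega) rfl rfl rfl h1 h2 h3 h4
    · rcases Nat.eq_zero_or_pos i with h | h
      · refine Or.inl ⟨h, ?_⟩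
        rw [show M + (3 * (b + b) - 1) + i - 1 = M + (3 * (b + b) - 2) by omega,
          hM _ (by omega) (by omega) (by omega)]
        have := grundyPeriod_cases ha (3 * (b + b) - 2)
        omega
      · refine Or.inr ⟨h, ?_⟩
        rw [← ih (i - 1) (by omega) (by omega)]
        congr 1
        omega
    · by_cases h : i = b + b - 2
      · refine Or.inl ⟨h, congrArg G ?_⟩
        omega
      by_cases h3 : i = b + b - 3
      · refine Or.inr (Or.inl ⟨h3, congrArg G ?_⟩)
        omega
      · by_cases h' : i < b + b
        · refine Or.inr (Or.inr ⟨_, ?_, Or.inl ⟨h', h, h3, rfl⟩⟩)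
          rw [← hM _ (by omega) (by omega) (by omega)]
          congr 1
          omega
        · refine Or.inr (Or.inr ⟨i - (b + b), ?_, Or.inr (by omega)⟩)
          rw [← ih _ (by omega) (by omega)]
          congr 1
          omega
    · by_cases h : i = 3 * (b + b) - 4
      · refine Or.inl ⟨h, congrArg G ?_⟩
        omega
      by_cases h3 : i = 3 * (b + b) - 5
      · refine Or.inr (Or.inl ⟨h3, congrArg G ?_⟩)
        omega
      · by_cases h' : i = 3 * (b + b) - 2
        · refine Or.inr (Or.inr ⟨_, ?_, Or.inl ⟨h', rfl⟩⟩)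
          rw [← ih _ (by omega) (by omega)]
          congr 1
          omega
        · refine Or.inr (Or.inr ⟨_, ?_, Or.inr ⟨h', h, h3, rfl⟩⟩)
          rw [← hM _ (by omega) (by omega) (by omega)]
          congr 1
          omega

theorem eq_grundyStart (hG : IsGrundy {1, a, 3 * a - 2} G) (ha : 4 < a) (heven : Even a) :
    ∀ n < 3 * a + 1, G n = grundyStart a n := by
  refine hG.eq_of_lt ?_ _ _ ?_ ?_
  · simp only [Finset.mem_insert, Finset.mem_singleton]
    omega
  · simp only [Finset.mem_insert, Finset.mem_singleton]
    rintro n hn s (rfl | rfl | rfl) hs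
    · exact grundyStart_sub_one_ne ha heven hn hs
    · exact grundyStart_sub_ne ha heven hn hs
    · exact grundyStart_sub_ne' ha heven hn hs
  · intro n hn w hw
    rcases grundyStart_lt ha heven hn hw with h | h | h
    · exact ⟨1, by simp, h⟩
    · exact ⟨a, by simp, h⟩
    · exact ⟨3 * a - 2, by simp, h⟩

theorem eq_getD_four (hG : IsGrundy {1, 4, 3 * 4 - 2} G) :
    ∀ n < 35, G n = grundyFour.getD n 0 :=
  hG.eq_of_lt (by decide) _ _ (by decide) (by decide)

theorem add_mul_block (hG : IsGrundy {1, a, 3 * a - 2} G) (ha : 4 ≤ a) (heven : Even a) {M : ℕ}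
    (hM : ∀ i < 3 * a - 1, G (M + i) = grundyPeriod a i) (k : ℕ) :
    ∀ i < 3 * a - 1, G (M + k * (3 * a - 1) + i) = grundyPeriod a i := by
  induction k with
  | zero => simpa using hM
  | succ k ih =>
    intro i hi
    have hM' : G (M + k * (3 * a - 1) + (3 * a - 3)) = 1 := by
      obtain ⟨b, rfl⟩ := heven
      rw [ih _ (by omega)]
      have := grundyPeriod_cases ha (3 * (b + b) - 3)
      omega
    have hM'' : G (M + k * (3 * a - 1) + (3 * a - 4)) = 0 := by
      obtain ⟨b, rfl⟩ := heven
      rw [ih _ (by omega)]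
      have := grundyPeriod_cases ha (3 * (b + b) - 4)
      omega
    rw [← hG.next_block ha heven (fun i hi _ _ => ih i hi) (Or.inl hM') (Or.inl hM'') i hi]
    congr 1
    ring

theorem add_period (hG : IsGrundy {1, a, 3 * a - 2} G) (ha : 4 ≤ a) (heven : Even a) {M : ℕ}
    (hM : ∀ i < 3 * a - 1, G (M + i) = grundyPeriod a i) {n : ℕ} (hn : M ≤ n) :
    G (n + (3 * a - 1)) = G n := by
  have hlt : (n - M) % (3 * a - 1) < 3 * a - 1 := Nat.mod_lt _ (by omega)
  have hdiv := Nat.div_add_mod' (n - M) (3 * a - 1)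
  have h1 := hG.add_mul_block ha heven hM ((n - M) / (3 * a - 1)) _ hlt
  have h2 := hG.add_mul_block ha heven hM ((n - M) / (3 * a - 1) + 1) _ hlt
  rw [Nat.succ_mul] at h2
  rw [show n + (3 * a - 1) = M + ((n - M) / (3 * a - 1) * (3 * a - 1) + (3 * a - 1)) +
    (n - M) % (3 * a - 1) by omega, h2, ← h1]
  congr 1
  omega

theorem add_mul_period {N p : ℕ} (hP : ∀ n, N ≤ n → G (n + p) = G n) {n : ℕ} (hn : N ≤ n)
    (k : ℕ) : G (n + k * p) = G n := by
  induction k with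
  | zero => simp
  | succ k ih => rw [Nat.succ_mul, ← Nat.add_assoc, hP _ (by omega), ih]

/-- Residues modulo the period that are excluded by the periodic part of the sequence. -/
theorem exists_apply_add_eq {N c : ℕ} (ha : 4 ≤ a) (heven : Even a)
    (hP : ∀ n, N ≤ n → G (n + (3 * a - 1)) = G n)
    (hT : ∀ i < 3 * a - 1, G (N + i) = grundyPeriod a i)
    (h1 : c % (3 * a - 1) ≠ 1) (h2 : c % (3 * a - 1) ≠ a) (h3 : c % (3 * a - 1) ≠ 2 * a - 1)
    (h4 : c % (3 * a - 1) ≠ 3 * a - 2) : ∃ n, G (n + c) = G n := by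
  have hc := Nat.div_add_mod' c (3 * a - 1)
  have hlt : c % (3 * a - 1) < 3 * a - 1 := Nat.mod_lt _ (by omega)
  generalize c % (3 * a - 1) = r at *
  generalize c / (3 * a - 1) = m at *
  obtain ⟨b, rfl⟩ := heven
  have key : ∀ i j, i < 3 * (b + b) - 1 → j < 3 * (b + b) - 1 →
      (i + r = j ∨ i + r = j + (3 * (b + b) - 1)) →
      grundyPeriod (b + b) j = grundyPeriod (b + b) i → ∃ n, G (n + c) = G n := by
    intro i j hi hj hij h
    refine ⟨N + i, ?_⟩
    rw [hT i hi, ← h, ← hT j hj]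
    rcases hij with hij | hij
    · rw [← add_mul_period hP (Nat.le_add_right N j) m]
      congr 1
      omega
    · rw [← add_mul_period hP (Nat.le_add_right N j) (m + 1), Nat.succ_mul]
      congr 1
      omega
  have mk : ∀ i j, i < 3 * (b + b) - 1 → j < 3 * (b + b) - 1 →
      (i + r = j ∨ i + r = j + (3 * (b + b) - 1)) →
      grundyPeriod (b + b) j = 0 → grundyPeriod (b + b) i = 0 → ∃ n, G (n + c) = G n :=
    fun i j hi hj hij h h' => key i j hi hj hij (h.trans h'.symm)
  have hfst : ∀ i, i ≤ b + b - 4 → i % 2 = 0 → grundyPeriod (b + b) i = 0 := by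
    intro i hi hi'
    have := grundyPeriod_cases ha i
    omega
  have hmid : ∀ i, b + b - 1 ≤ i → i ≤ 2 * (b + b) - 3 → i % 2 = 1 →
      grundyPeriod (b + b) i = 0 := by
    intro i hi hi' hi''
    have := grundyPeriod_cases ha i
    omega
  have hlst : ∀ i, 2 * (b + b) ≤ i → i ≤ 3 * (b + b) - 4 → i % 2 = 0 →
      grundyPeriod (b + b) i = 0 := by
    intro i hi hi' hi''
    obtain ⟨k, rfl⟩ := Nat.dvd_of_mod_eq_zero hi''
    have := grundyPeriod_cases ha (2 * k)
    omega
  rcases Nat.mod_two_eq_zero_or_one r with hr | hr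
  · by_cases r0 : r = 0
    · exact key 0 0 (by omega) (by omega) (by omega) rfl
    by_cases r1 : r ≤ b + b - 2
    · exact mk (b + b - 1) (b + b - 1 + r) (by omega) (by omega) (by omega)
        (hmid _ (by omega) (by omega) (by omega)) (hmid _ (by omega) (by omega) (by omega))
    by_cases r2 : r = b + b + 2
    · exact mk (2 * (b + b) - 3) 0 (by omega) (by omega) (by omega)
        (hfst _ (by omega) (by omega)) (hmid _ (by omega) (by omega) (by omega))
    by_cases r3 : r < 2 * (b + b)
    · exact mk (2 * (b + b) - r) (2 * (b + b)) (by omega) (by omega) (by omega)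
        (hlst _ (by omega) (by omega) (by omega)) (hfst _ (by omega) (by omega))
    · exact mk 0 r (by omega) (by omega) (by omega)
        (hlst _ (by omega) (by omega) (by omega)) (hfst _ (by omega) (by omega))
  · by_cases r1 : r < b + b - 1
    · exact mk (b + b - 1 - r) (b + b - 1) (by omega) (by omega) (by omega)
        (hmid _ (by omega) (by omega) (by omega)) (hfst _ (by omega) (by omega))
    by_cases r2 : r ≤ 2 * (b + b) - 3
    · exact mk 0 r (by omega) (by omega) (by omega)
        (hmid _ (by omega) (by omega) (by omega)) (hfst _ (by omega) (by omega))
    · exact mk (2 * (b + b) - 3) (2 * (b + b) - 3 - (3 * (b + b) - 1 - r))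
        (by omega) (by omega) (by omega)
        (hmid _ (by omega) (by omega) (by omega)) (hmid _ (by omega) (by omega) (by omega))

theorem eq_grundyPeriod (hG : IsGrundy {1, a, 3 * a - 2} G) (ha : 4 < a) (heven : Even a) :
    ∀ i < 3 * a - 1, G (3 * a + 1 + i) = grundyPeriod a i := by
  have hS := hG.eq_grundyStart ha heven
  obtain ⟨b, rfl⟩ := heven
  intro i hi
  rw [← hG.next_block (M := 2) (by omega) ⟨b, rfl⟩ ?_ ?_ ?_ i hi]
  · congr 1
    omega
  · intro i hi hi' hi''
    rw [hS _ (by omega)]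
    have h1 := grundyStart_cases ha (2 + i)
    have h2 := grundyPeriod_cases ha.le i
    omega
  · rw [hS _ (by omega)]
    have h1 := grundyStart_cases ha (2 + (3 * (b + b) - 3))
    omega
  · rw [hS _ (by omega)]
    have h1 := grundyStart_cases ha (2 + (3 * (b + b) - 4))
    omega

theorem eq_grundyPeriod_four (hG : IsGrundy {1, 4, 3 * 4 - 2} G) :
    ∀ i < 3 * 4 - 1, G (24 + i) = grundyPeriod 4 i := by
  intro i hi
  rw [hG.eq_getD_four _ (by omega)]
  revert i
  decide

/-- For `4 < a`, the sequence is periodic from position `3 * a` on. -/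
theorem add_period_of_three_mul_le (hG : IsGrundy {1, a, 3 * a - 2} G) (ha : 4 < a)
    (heven : Even a) {n : ℕ} (hn : 3 * a ≤ n) : G (n + (3 * a - 1)) = G n := by
  rcases hn.eq_or_lt with rfl | hn
  · have h1 := hG.eq_grundyPeriod ha heven (3 * a - 2) (by omega)
    have h2 := hG.eq_grundyStart ha heven (3 * a) (by omega)
    have h3 := grundyPeriod_cases ha.le (3 * a - 2)
    have h4 := grundyStart_cases ha (3 * a)
    rw [show 3 * a + (3 * a - 1) = 3 * a + 1 + (3 * a - 2) by omega]
    omega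
  · exact hG.add_period ha.le heven (hG.eq_grundyPeriod ha heven) hn

theorem apply_add_three_mul_ne (hG : IsGrundy {1, a, 3 * a - 2} G) (ha : 4 < a)
    (heven : Even a) (n : ℕ) : G (n + 3 * a) ≠ G n := by
  by_cases hn : 3 * a ≤ n + 1
  · have h := hG.add_period_of_three_mul_le ha heven hn
    rw [show n + 3 * a = n + 1 + (3 * a - 1) by omega, h]
    exact hG.apply_add_ne (by simp) n
  · have h1 := hG.eq_grundyStart ha heven n (by omega)
    have h2 := grundyStart_cases ha n
    rcases Nat.eq_zero_or_pos n with rfl | hn'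
    · have h3 := hG.eq_grundyStart ha heven (0 + 3 * a) (by omega)
      have h4 := grundyStart_cases ha (0 + 3 * a)
      omega
    · have h3 := hG.eq_grundyPeriod ha heven (n - 1) (by omega)
      have h4 := grundyPeriod_cases ha.le (n - 1)
      rw [show 3 * a + 1 + (n - 1) = n + 3 * a by omega] at h3
      obtain ⟨b, rfl⟩ := heven
      rw [h1, h3]
      clear h1 h3
      rcases h2 with h2 | h2 | h2 | h2 | h2 | h2 | h2 <;> omega

theorem apply_add_four_mul_sub_one_ne (hG : IsGrundy {1, a, 3 * a - 2} G) (ha : 4 < a)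
    (heven : Even a) (n : ℕ) : G (n + (4 * a - 1)) ≠ G n := by
  by_cases hn : 3 * a ≤ n + a
  · have h := hG.add_period_of_three_mul_le ha heven hn
    rw [show n + (4 * a - 1) = n + a + (3 * a - 1) by omega, h]
    exact hG.apply_add_ne (by simp) n
  · have h1 := hG.eq_grundyStart ha heven n (by omega)
    have h2 := grundyStart_cases ha n
    have h3 := hG.eq_grundyPeriod ha heven (n + a - 2) (by omega)
    have h4 := grundyPeriod_cases ha.le (n + a - 2)
    rw [show 3 * a + 1 + (n + a - 2) = n + (4 * a - 1) by omega] at h3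
    obtain ⟨b, rfl⟩ := heven
    rw [h1, h3]
    clear h1 h3
    rcases h2 with h2 | h2 | h2 | h2 | h2 | h2 | h2 <;> omega

theorem forall_apply_add_ne_iff (hG : IsGrundy {1, a, 3 * a - 2} G) (ha : 4 < a)
    (heven : Even a) (c : ℕ) :
    (∀ n, G (n + c) ≠ G n) ↔
      (c = 1 ∨ c = a ∨ c = 3 * a - 2 ∨ c = 3 * a ∨
        ∃ s m : ℕ, c = s + m * (3 * a - 1) ∧ (s = 4 * a - 1 ∨ s = 6 * a - 1)) := by
  have hP : ∀ n, 3 * a ≤ n → G (n + (3 * a - 1)) = G n :=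
    fun n hn => hG.add_period_of_three_mul_le ha heven hn
  have hT := hG.eq_grundyPeriod ha heven
  constructor
  · intro h
    by_contra hc
    have hex : c % (3 * a - 1) = 1 ∨ c % (3 * a - 1) = a ∨ c % (3 * a - 1) = 2 * a - 1 ∨
        c % (3 * a - 1) = 3 * a - 2 := by
      by_contra! h'
      obtain ⟨n, hn⟩ := exists_apply_add_eq ha.le heven (fun n hn => hP n (by omega)) hT
        h'.1 h'.2.1 h'.2.2.1 h'.2.2.2
      exact h n hn
    have hdiv := Nat.div_add_mod' c (3 * a - 1)
    generalize c % (3 * a - 1) = r at *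
    generalize c / (3 * a - 1) = m at *
    have h0 := hG.eq_grundyStart ha heven 0 (by omega)
    have h0' := grundyStart_cases ha 0
    have hne := h 0
    rw [Nat.zero_add] at hne
    obtain ⟨b, rfl⟩ := heven
    rcases hex with rfl | rfl | rfl | rfl
    · rcases m with _ | _ | m
      · exact hc (by omega)
      · exact hc (by omega)
      · refine hc (Or.inr (Or.inr (Or.inr (Or.inr ⟨6 * (b + b) - 1, m, ?_, Or.inr rfl⟩))))
        rw [Nat.succ_mul, Nat.succ_mul] at hdiv
        omega
    · rcases m with _ | m
      · exact hc (by omega)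
      · refine hc (Or.inr (Or.inr (Or.inr (Or.inr ⟨4 * (b + b) - 1, m, ?_, Or.inl rfl⟩))))
        rw [Nat.succ_mul] at hdiv
        omega
    · rcases m with _ | m
      · have h1 := hG.eq_grundyStart ha ⟨b, rfl⟩ c (by omega)
        have h1' := grundyStart_cases ha c
        omega
      · have h1 := hT (2 * (b + b) - 3) (by omega)
        have h1' := grundyPeriod_cases ha.le (2 * (b + b) - 3)
        rw [← add_mul_period hP (by omega) m] at h1
        rw [Nat.succ_mul] at hdiv
        rw [show c = 3 * (b + b) + 1 + (2 * (b + b) - 3) + m * (3 * (b + b) - 1) by omega] at hne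
        omega
    · rcases m with _ | m
      · exact hc (by omega)
      · have h1 := hT (3 * (b + b) - 4) (by omega)
        have h1' := grundyPeriod_cases ha.le (3 * (b + b) - 4)
        rw [← add_mul_period hP (by omega) m] at h1
        rw [Nat.succ_mul] at hdiv
        rw [show c = 3 * (b + b) + 1 + (3 * (b + b) - 4) + m * (3 * (b + b) - 1) by omega] at hne
        omega
  · rintro (rfl | rfl | rfl | rfl | ⟨s, m, rfl, rfl | rfl⟩) n
    · exact hG.apply_add_ne (by simp) n
    · exact hG.apply_add_ne (by simp) n
    · exact hG.apply_add_ne (by simp) n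
    · exact hG.apply_add_three_mul_ne ha heven n
    · rw [← Nat.add_assoc, add_mul_period hP (by omega)]
      exact hG.apply_add_four_mul_sub_one_ne ha heven n
    · rw [← Nat.add_assoc, add_mul_period hP (by omega),
        show n + (6 * a - 1) = n + 3 * a + (3 * a - 1) by omega, hP _ (by omega)]
      exact hG.apply_add_three_mul_ne ha heven n

theorem forall_apply_add_ne_iff_four (hG : IsGrundy {1, 4, 3 * 4 - 2} G) (c : ℕ) :
    (∀ n, G (n + c) ≠ G n) ↔ (c = 1 ∨ c = 4 ∨ c = 10) := by
  have hT := hG.eq_grundyPeriod_four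
  have hP : ∀ n, 24 ≤ n → G (n + (3 * 4 - 1)) = G n :=
    fun n hn => hG.add_period le_rfl (by decide) hT hn
  have hV := hG.eq_getD_four
  constructor
  · intro h
    by_contra hc
    have hex : c % 11 = 1 ∨ c % 11 = 4 ∨ c % 11 = 7 ∨ c % 11 = 10 := by
      by_contra! h'
      obtain ⟨n, hn⟩ := exists_apply_add_eq le_rfl (by decide) hP hT
        h'.1 h'.2.1 h'.2.2.1 h'.2.2.2
      exact h n hn
    have hdiv := Nat.div_add_mod' c 11
    have h0 := hV 0 (by omega)
    have h11 := hV 11 (by omega)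
    have hlate : ∀ n i m, 24 ≤ i → i < 35 → n + c = i + m * 11 →
        grundyFour.getD i 0 ≠ G n := by
      intro n i m hi hi' hn
      rw [← hV i hi', ← add_mul_period hP hi m]
      norm_num
      rw [← hn]
      exact h n
    have hearly : ∀ n i, i < 35 → n + c = i → grundyFour.getD i 0 ≠ G n := by
      intro n i hi' hn
      rw [← hV i hi', ← hn]
      exact h n
    generalize c % 11 = r at *
    generalize c / 11 = m at *
    rcases hex with rfl | rfl | rfl | rfl
    · rcases m with _ | _ | m
      · omega
      · exact hearly 11 23 (by omega) (by omega) h11.symm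
      · exact hlate 11 34 m (by omega) (by omega) (by omega) h11.symm
    · rcases m with _ | m
      · omega
      · exact hlate 11 26 m (by omega) (by omega) (by omega) h11.symm
    · rcases m with _ | _ | m
      · exact hearly 0 7 (by omega) (by omega) h0.symm
      · exact hearly 0 18 (by omega) (by omega) h0.symm
      · exact hlate 0 29 m (by omega) (by omega) (by omega) h0.symm
    · rcases m with _ | _ | m
      · omega
      · exact hearly 0 21 (by omega) (by omega) h0.symm
      · exact hlate 0 32 m (by omega) (by omega) (by omega) h0.symm
  · rintro (rfl | rfl | rfl) n <;> exact hG.apply_add_ne (by simp) n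

theorem exists_eq_grundyPeriod (hG : IsGrundy {1, a, 3 * a - 2} G) (ha : 4 ≤ a)
    (heven : Even a) : ∃ N, ∀ i < 3 * a - 1, G (N + i) = grundyPeriod a i := by
  rcases ha.eq_or_lt with rfl | ha
  · exact ⟨24, hG.eq_grundyPeriod_four⟩
  · exact ⟨_, hG.eq_grundyPeriod ha heven⟩

end IsGrundy

theorem stmt_8 (a : ℕ) (ha : 4 ≤ a) (haeven : Even a) (G : ℕ → ℕ)
    (hG : IsGrundy {1, a, 3 * a - 2} G) :
    (∃ N : ℕ, (∀ n, N ≤ n → G (n + (3 * a - 1)) = G n) ∧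
      ∀ i < 3 * a - 1,
        (i ≤ a - 3 → G (N + i) = i % 2) ∧
        (i = a - 2 → G (N + i) = 2) ∧
        (a - 1 ≤ i → i ≤ 2 * a - 2 → G (N + i) = (i + 1 - a) % 2) ∧
        (i = 2 * a - 1 → G (N + i) = 2) ∧
        (2 * a ≤ i → i ≤ 3 * a - 3 → G (N + i) = (i - 2 * a) % 2) ∧
        (i = 3 * a - 2 → G (N + i) = 2)) ∧
    ((a = 4 → ∀ c, 1 ≤ c →
      ((∀ n, G (n + c) ≠ G n) ↔ (c = 1 ∨ c = 4 ∨ c = 10))) ∧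
     (4 < a → ∀ c, 1 ≤ c →
      ((∀ n, G (n + c) ≠ G n) ↔
        (c = 1 ∨ c = a ∨ c = 3 * a - 2 ∨ c = 3 * a ∨
          ∃ s m : ℕ, c = s + m * (3 * a - 1) ∧
            (s = 4 * a - 1 ∨ s = 6 * a - 1))))) := by
  obtain ⟨N, hN⟩ := hG.exists_eq_grundyPeriod ha haeven
  refine ⟨⟨N, fun n hn => hG.add_period ha haeven hN hn, fun i hi => ?_⟩, ?_, ?_⟩
  · rw [hN i hi]
    have h := grundyPeriod_cases ha i
    refine ⟨?_, ?_, ?_, ?_, ?_, ?_⟩ <;> intros <;> omega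
  · rintro rfl c -
    exact hG.forall_apply_add_ne_iff_four c
  · intro ha c _
    exact hG.forall_apply_add_ne_iff ha haeven c
end
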